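/- arXiv:1810.00963 — 2 statements merged into one kernel-verified Lean document; each statement's English description precedes it below -/
import Mathlib

section
/- Let 1 ≤ p < q < ∞ and d ≥ 1. Then the Dunkl–Williams constant of the Morrey space M^p_q(ℝ^d) equals 4; that is, sup{ ((‖f‖_{M^p_q} + ‖g‖_{M^p_q}) / ‖f−g‖_{M^p_q}) · ‖ f/‖f‖_{M^p_q} − g/‖g‖_{M^p_q} ‖_{M^p_q} : f, g ∈ M^p_q(ℝ^d), f ≠ 0, g ≠ 0, f ≠ g } = 4. -/
open MeasureTheory
open scoped ENNReal

/-- The Morrey norm `‖f‖_{M^p_q}` of a (measurable) function on `ℝ^d`: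
the supremum over all balls `B = B(a,r)` of `|B|^(1/q - 1/p) (∫_B |f|^p)^(1/p)`. -/
noncomputable def morreyNorm (p q : ℝ) (d : ℕ) (f : EuclideanSpace ℝ (Fin d) → ℝ) : ℝ≥0∞ :=
  ⨆ (a : EuclideanSpace ℝ (Fin d)) (r : ℝ) (_ : 0 < r),
    volume (Metric.ball a r) ^ ((1:ℝ)/q - 1/p) *
      (∫⁻ y in Metric.ball a r, ENNReal.ofReal (|f y| ^ p)) ^ ((1:ℝ)/p)

section

variable {p q : ℝ} {d : ℕ}

theorem morreyNorm_eq_iSup_eLpNorm (q : ℝ) (hp : 0 < p) (f : EuclideanSpace ℝ (Fin d) → ℝ) :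
    morreyNorm p q d f = ⨆ (a : EuclideanSpace ℝ (Fin d)) (r : ℝ) (_ : 0 < r),
      volume (Metric.ball a r) ^ ((1:ℝ)/q - 1/p) *
        eLpNorm f (ENNReal.ofReal p) (volume.restrict (Metric.ball a r)) := by
  unfold morreyNorm
  congr! with a r hr
  rw [eLpNorm_eq_lintegral_rpow_enorm_toReal (by simpa using hp) ENNReal.ofReal_ne_top,
    ENNReal.toReal_ofReal hp.le]
  simp_rw [Real.enorm_eq_ofReal_abs, ENNReal.ofReal_rpow_of_nonneg (abs_nonneg _) hp.le]

theorem morreyNorm_const_smul (q : ℝ) (hp : 0 < p) (c : ℝ) (f : EuclideanSpace ℝ (Fin d) → ℝ) :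
    morreyNorm p q d (c • f) = ENNReal.ofReal |c| * morreyNorm p q d f := by
  simp only [morreyNorm_eq_iSup_eLpNorm q hp, ENNReal.mul_iSup, eLpNorm_const_smul,
    Real.enorm_eq_ofReal_abs]
  simp only [mul_left_comm]

theorem morreyNorm_sub_comm (q : ℝ) (hp : 0 < p) (f g : EuclideanSpace ℝ (Fin d) → ℝ) :
    morreyNorm p q d (f - g) = morreyNorm p q d (g - f) := by
  rw [← neg_sub g f, ← neg_one_smul ℝ (g - f), morreyNorm_const_smul q hp]
  simp

theorem morreyNorm_add_le (q : ℝ) (hp : 1 ≤ p) {f g : EuclideanSpace ℝ (Fin d) → ℝ}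
    (hf : Measurable f) (hg : Measurable g) :
    morreyNorm p q d (f + g) ≤ morreyNorm p q d f + morreyNorm p q d g := by
  simp only [morreyNorm_eq_iSup_eLpNorm q (zero_lt_one.trans_le hp)]
  refine iSup_le fun a => iSup_le fun r => iSup_le fun hr => ?_
  refine (mul_le_mul_right (eLpNorm_add_le hf.aestronglyMeasurable hg.aestronglyMeasurable
    (by simpa using hp)) _).trans ?_
  rw [mul_add]
  exact add_le_add (le_iSup_of_le a <| le_iSup_of_le r <| le_iSup_of_le hr le_rfl)
    (le_iSup_of_le a <| le_iSup_of_le r <| le_iSup_of_le hr le_rfl)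

/-- The Massera–Schäffer inequality for the Morrey norm. -/
theorem morreyNorm_mul_normalize_sub_le (q : ℝ) (hp : 1 ≤ p)
    {f g : EuclideanSpace ℝ (Fin d) → ℝ} (hf : Measurable f) (hg : Measurable g)
    (hf_top : morreyNorm p q d f ≠ ∞) (hg_top : morreyNorm p q d g ≠ ∞)
    (hf0 : morreyNorm p q d f ≠ 0) (hg0 : morreyNorm p q d g ≠ 0) :
    morreyNorm p q d f * morreyNorm p q d
      ((morreyNorm p q d f).toReal⁻¹ • f - (morreyNorm p q d g).toReal⁻¹ • g) ≤
      2 * morreyNorm p q d (f - g) := by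
  have hp0 : 0 < p := zero_lt_one.trans_le hp
  set a := (morreyNorm p q d f).toReal with ha
  set b := (morreyNorm p q d g).toReal with hb
  have ha0 : 0 < a := ENNReal.toReal_pos hf0 hf_top
  have hb0 : 0 < b := ENNReal.toReal_pos hg0 hg_top
  have hfa : morreyNorm p q d f = ENNReal.ofReal a := (ENNReal.ofReal_toReal hf_top).symm
  have hgb : morreyNorm p q d g = ENNReal.ofReal b := (ENNReal.ofReal_toReal hg_top).symm
  have hab : ENNReal.ofReal |b - a| ≤ morreyNorm p q d (f - g) := by
    have h1 : ENNReal.ofReal a ≤ morreyNorm p q d (f - g) + ENNReal.ofReal b := by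
      rw [← hfa, ← hgb]
      simpa using morreyNorm_add_le q hp (hf.sub hg) hg
    have h2 : ENNReal.ofReal b ≤ morreyNorm p q d (f - g) + ENNReal.ofReal a := by
      rw [← hfa, ← hgb, morreyNorm_sub_comm q hp0 f]
      simpa using morreyNorm_add_le q hp (hg.sub hf) hf
    rcases abs_cases (b - a) with ⟨h, -⟩ | ⟨h, -⟩
    · rw [h, ENNReal.ofReal_sub _ ha0.le]
      exact tsub_le_iff_right.2 h2
    · rw [h, neg_sub, ENNReal.ofReal_sub _ hb0.le]
      exact tsub_le_iff_right.2 h1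
  have hdecomp : a • (a⁻¹ • f - b⁻¹ • g) = (f - g) + (1 - a / b) • g := by
    ext x
    simp only [Pi.smul_apply, Pi.sub_apply, Pi.add_apply, smul_eq_mul]
    field_simp
    ring
  calc morreyNorm p q d f * morreyNorm p q d (a⁻¹ • f - b⁻¹ • g)
      = morreyNorm p q d ((f - g) + (1 - a / b) • g) := by
        rw [← hdecomp, morreyNorm_const_smul q hp0, abs_of_pos ha0, ← hfa]
    _ ≤ morreyNorm p q d (f - g) + morreyNorm p q d ((1 - a / b) • g) :=
        morreyNorm_add_le q hp (hf.sub hg) (hg.const_smul _)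
    _ = morreyNorm p q d (f - g) + ENNReal.ofReal |b - a| := by
        rw [morreyNorm_const_smul q hp0, hgb, ← ENNReal.ofReal_mul (abs_nonneg _)]
        congr 2
        rw [← abs_of_pos hb0, ← abs_mul, abs_of_pos hb0]
        congr 1
        field_simp
    _ ≤ 2 * morreyNorm p q d (f - g) := by
        rw [two_mul]
        gcongr

/-- The Dunkl–Williams inequality for the Morrey norm. -/
theorem dunklWilliams_morrey_le (q : ℝ) (hp : 1 ≤ p)
    {f g : EuclideanSpace ℝ (Fin d) → ℝ} (hf : Measurable f) (hg : Measurable g)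
    (hf_top : morreyNorm p q d f ≠ ∞) (hg_top : morreyNorm p q d g ≠ ∞)
    (hf0 : morreyNorm p q d f ≠ 0) (hg0 : morreyNorm p q d g ≠ 0) :
    ((morreyNorm p q d f + morreyNorm p q d g) / morreyNorm p q d (f - g)) *
      morreyNorm p q d
        ((morreyNorm p q d f).toReal⁻¹ • f - (morreyNorm p q d g).toReal⁻¹ • g) ≤ 4 := by
  have hp0 : 0 < p := zero_lt_one.trans_le hp
  have h1 := morreyNorm_mul_normalize_sub_le q hp hf hg hf_top hg_top hf0 hg0
  have h2 := morreyNorm_mul_normalize_sub_le q hp hg hf hg_top hf_top hg0 hf0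
  rw [morreyNorm_sub_comm q hp0, morreyNorm_sub_comm q hp0 g f] at h2
  rw [div_eq_mul_inv, mul_right_comm, ← div_eq_mul_inv]
  refine ENNReal.div_le_of_le_mul ?_
  rw [add_mul]
  refine (add_le_add h1 h2).trans_eq ?_
  rw [← add_mul]
  norm_num

/-- The combination of the indicators of two unit balls with coefficients `s` and `t`. -/
noncomputable def twoBumps (x y : EuclideanSpace ℝ (Fin d)) (s t : ℝ) :
    EuclideanSpace ℝ (Fin d) → ℝ :=
  (Metric.ball x 1).indicator (fun _ => s) + (Metric.ball y 1).indicator (fun _ => t)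

theorem measurable_twoBumps (x y : EuclideanSpace ℝ (Fin d)) (s t : ℝ) :
    Measurable (twoBumps x y s t) :=
  (measurable_const.indicator measurableSet_ball).add
    (measurable_const.indicator measurableSet_ball)

theorem smul_twoBumps (x y : EuclideanSpace ℝ (Fin d)) (c s t : ℝ) :
    c • twoBumps x y s t = twoBumps x y (c * s) (c * t) := by
  ext z
  simp only [twoBumps, Pi.smul_apply, Pi.add_apply, Set.indicator, smul_eq_mul]
  split_ifs <;> ring

theorem twoBumps_sub_twoBumps (x y : EuclideanSpace ℝ (Fin d)) (s t s' t' : ℝ) :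
    twoBumps x y s t - twoBumps x y s' t' = twoBumps x y (s - s') (t - t') := by
  ext z
  simp only [twoBumps, Pi.sub_apply, Pi.add_apply, Set.indicator]
  split_ifs <;> ring

theorem twoBumps_comm (x y : EuclideanSpace ℝ (Fin d)) (s t : ℝ) :
    twoBumps x y s t = twoBumps y x t s :=
  add_comm _ _

theorem le_morreyNorm_twoBumps (q : ℝ) (hp : 0 < p) {x y : EuclideanSpace ℝ (Fin d)}
    (hxy : 2 ≤ dist x y) (s t : ℝ) :
    ENNReal.ofReal |s| * volume (Metric.ball (0 : EuclideanSpace ℝ (Fin d)) 1) ^ (1 / q) ≤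
      morreyNorm p q d (twoBumps x y s t) := by
  have hdisj : Disjoint (Metric.ball x 1) (Metric.ball y 1) :=
    Metric.ball_disjoint_ball (by linarith)
  have hV0 : volume (Metric.ball x 1) ≠ 0 := (Metric.measure_ball_pos volume x one_pos).ne'
  have hVt : volume (Metric.ball x 1) ≠ ∞ := measure_ball_lt_top.ne
  rw [morreyNorm]
  refine le_iSup_of_le x <| le_iSup_of_le 1 <| le_iSup_of_le one_pos <| le_of_eq ?_
  have : ∫⁻ z in Metric.ball x 1, ENNReal.ofReal (|twoBumps x y s t z| ^ p) =
      ENNReal.ofReal |s| ^ p * volume (Metric.ball x 1) := by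
    rw [← setLIntegral_const]
    refine setLIntegral_congr_fun measurableSet_ball fun z hz => ?_
    have hz' : z ∉ Metric.ball y 1 := Set.disjoint_left.1 hdisj hz
    simp only [twoBumps, Pi.add_apply, Set.indicator_of_mem hz, Set.indicator_of_notMem hz',
      add_zero]
    rw [ENNReal.ofReal_rpow_of_nonneg (abs_nonneg _) hp.le]
  rw [this, ENNReal.mul_rpow_of_nonneg _ _ (by positivity), ← ENNReal.rpow_mul,
    mul_one_div_cancel hp.ne', ENNReal.rpow_one, mul_left_comm, ← ENNReal.rpow_add _ _ hV0 hVt,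
    sub_add_cancel, ← Measure.addHaar_ball_center volume x 1]

theorem ennreal_rpow_le_rpow_of_nonpos {x y : ℝ≥0∞} {z : ℝ} (hz : z ≤ 0) (h : x ≤ y) :
    y ^ z ≤ x ^ z := by
  rw [← neg_neg z, ENNReal.rpow_neg y, ENNReal.rpow_neg x, ENNReal.inv_le_inv]
  exact ENNReal.rpow_le_rpow h (neg_nonneg.2 hz)

theorem ennreal_rpow_sub_mul_rpow_le {D M V : ℝ≥0∞} (hp : 0 < p) (hpq : p < q)
    (hD0 : D ≠ 0) (hDt : D ≠ ∞) (hV0 : V ≠ 0) (hVt : V ≠ ∞) (hMD : M ≤ D) (hMV : M ≤ V) :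
    D ^ ((1:ℝ)/q - 1/p) * M ^ ((1:ℝ)/p) ≤ V ^ ((1:ℝ)/q) := by
  have hq : 0 < q := hp.trans hpq
  have hlt : (1:ℝ)/q < 1/p := one_div_lt_one_div_of_lt hp hpq
  rcases le_total D V with h | h
  · calc D ^ ((1:ℝ)/q - 1/p) * M ^ ((1:ℝ)/p) ≤ D ^ ((1:ℝ)/q - 1/p) * D ^ ((1:ℝ)/p) := by gcongr
      _ = D ^ ((1:ℝ)/q) := by rw [← ENNReal.rpow_add _ _ hD0 hDt, sub_add_cancel]
      _ ≤ V ^ ((1:ℝ)/q) := by gcongr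
  · calc D ^ ((1:ℝ)/q - 1/p) * M ^ ((1:ℝ)/p) ≤ V ^ ((1:ℝ)/q - 1/p) * V ^ ((1:ℝ)/p) :=
          mul_le_mul' (ennreal_rpow_le_rpow_of_nonpos (by linarith) h) (by gcongr)
      _ = V ^ ((1:ℝ)/q) := by rw [← ENNReal.rpow_add _ _ hV0 hVt, sub_add_cancel]

theorem morreyNorm_twoBumps_le (hp : 0 < p) (hpq : p < q) (hd : 1 ≤ d)
    {x y : EuclideanSpace ℝ (Fin d)}
    (hxy : 2 + 2 * (2:ℝ) ^ ((1 / p) / (1 / p - 1 / q)) ≤ dist x y) {s t m : ℝ}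
    (hs : |s| ≤ m) (ht : |t| ≤ m) :
    morreyNorm p q d (twoBumps x y s t) ≤
      ENNReal.ofReal m * volume (Metric.ball (0 : EuclideanSpace ℝ (Fin d)) 1) ^ (1 / q) := by
  set V := volume (Metric.ball (0 : EuclideanSpace ℝ (Fin d)) 1) with hV
  set K : ℝ := (2:ℝ) ^ ((1 / p) / (1 / p - 1 / q)) with hK
  have hlt : (1:ℝ)/q < 1/p := one_div_lt_one_div_of_lt hp hpq
  have hp' : 0 < 1 / p := by positivity
  have hK1 : 1 ≤ K := Real.one_le_rpow one_le_two (div_nonneg hp'.le (by linarith))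
  have hV0 : V ≠ 0 := (Metric.measure_ball_pos volume _ one_pos).ne'
  have hVt : V ≠ ∞ := measure_ball_lt_top.ne
  have hm : 0 ≤ m := (abs_nonneg s).trans hs
  have hVx (z : EuclideanSpace ℝ (Fin d)) : volume (Metric.ball z 1) = V :=
    Measure.addHaar_ball_center volume z 1
  have hdisj : Disjoint (Metric.ball x 1) (Metric.ball y 1) :=
    Metric.ball_disjoint_ball (by linarith)
  refine iSup_le fun a => iSup_le fun r => iSup_le fun hr => ?_
  set D := Metric.ball a r with hD
  have hD0 : volume D ≠ 0 := (Metric.measure_ball_pos volume _ hr).ne'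
  have hDt : volume D ≠ ∞ := measure_ball_lt_top.ne
  set E := Metric.ball x 1 ∪ Metric.ball y 1 with hE
  have hEm : MeasurableSet E := measurableSet_ball.union measurableSet_ball
  have hint : ∫⁻ z in D, ENNReal.ofReal (|twoBumps x y s t z| ^ p) ≤
      ENNReal.ofReal m ^ p * volume (E ∩ D) := by
    rw [← Measure.restrict_apply hEm, ← lintegral_indicator_const hEm]
    refine lintegral_mono fun z => ?_
    by_cases hzx : z ∈ Metric.ball x 1
    · have hzy : z ∉ Metric.ball y 1 := Set.disjoint_left.1 hdisj hzx
      rw [Set.indicator_of_mem (show z ∈ E from Or.inl hzx), ENNReal.ofReal_rpow_of_nonneg hm hp.le]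
      simp only [twoBumps, Pi.add_apply, Set.indicator_of_mem hzx, Set.indicator_of_notMem hzy,
        add_zero]
      gcongr
    · by_cases hzy : z ∈ Metric.ball y 1
      · rw [Set.indicator_of_mem (show z ∈ E from Or.inr hzy), ENNReal.ofReal_rpow_of_nonneg hm hp.le]
        simp only [twoBumps, Pi.add_apply, Set.indicator_of_mem hzy, Set.indicator_of_notMem hzx,
          zero_add]
        gcongr
      · simp [twoBumps, Set.indicator_of_notMem hzx, Set.indicator_of_notMem hzy,
          Real.zero_rpow hp.ne']
  have hmain : volume D ^ ((1:ℝ)/q - 1/p) * volume (E ∩ D) ^ ((1:ℝ)/p) ≤ V ^ ((1:ℝ)/q) := by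
    by_cases hx : (Metric.ball x 1 ∩ D).Nonempty
    · by_cases hy : (Metric.ball y 1 ∩ D).Nonempty
      · obtain ⟨u, hux, hua⟩ := hx
        obtain ⟨v, hvy, hva⟩ := hy
        have hKr : K ≤ r := by
          rw [Metric.mem_ball] at hux hua hvy hva
          have h1 := dist_triangle4 x u a y
          have h2 := dist_triangle a v y
          rw [dist_comm] at hux
          rw [dist_comm] at hva
          linarith
        have hDK : ENNReal.ofReal K * V ≤ volume D := by
          rw [hD, Measure.addHaar_ball_of_pos volume a hr, finrank_euclideanSpace_fin]
          gcongr
          exact hKr.trans (le_self_pow₀ (hK1.trans hKr) (by omega))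
        have hEV : volume (E ∩ D) ≤ 2 * V := by
          calc volume (E ∩ D) ≤ volume E := measure_mono Set.inter_subset_left
            _ ≤ V + V := by simpa only [hVx] using measure_union_le (μ := volume)
                              (Metric.ball x 1) (Metric.ball y 1)
            _ = 2 * V := (two_mul V).symm
        have hKpow : ENNReal.ofReal K ^ ((1:ℝ)/q - 1/p) * 2 ^ ((1:ℝ)/p) = 1 := by
          have h2 : (2:ℝ≥0∞) = ENNReal.ofReal 2 := by simp
          rw [h2, ENNReal.ofReal_rpow_of_pos (by linarith), ENNReal.ofReal_rpow_of_pos two_pos,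
            ← ENNReal.ofReal_mul (by positivity), hK, ← Real.rpow_mul two_pos.le,
            ← Real.rpow_add two_pos]
          have : 1 / p / (1 / p - 1 / q) * (1 / q - 1 / p) + 1 / p = 0 := by
            have : (1:ℝ) / p - 1 / q ≠ 0 := by linarith
            rw [← neg_sub (1/p) (1/q), mul_neg, div_mul_cancel₀ _ this]
            ring
          rw [this]
          simp
        calc volume D ^ ((1:ℝ)/q - 1/p) * volume (E ∩ D) ^ ((1:ℝ)/p)
            ≤ (ENNReal.ofReal K * V) ^ ((1:ℝ)/q - 1/p) * (2 * V) ^ ((1:ℝ)/p) :=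
              mul_le_mul' (ennreal_rpow_le_rpow_of_nonpos (by linarith) hDK) (by gcongr)
          _ = (ENNReal.ofReal K ^ ((1:ℝ)/q - 1/p) * 2 ^ ((1:ℝ)/p)) *
                (V ^ ((1:ℝ)/q - 1/p) * V ^ ((1:ℝ)/p)) := by
              rw [ENNReal.mul_rpow_of_ne_top ENNReal.ofReal_ne_top hVt,
                ENNReal.mul_rpow_of_nonneg _ _ hp'.le]
              ring
          _ = V ^ ((1:ℝ)/q) := by
              rw [hKpow, one_mul, ← ENNReal.rpow_add _ _ hV0 hVt, sub_add_cancel]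
      · refine ennreal_rpow_sub_mul_rpow_le hp hpq hD0 hDt hV0 hVt
          (measure_mono Set.inter_subset_right) ?_
        rw [hE, Set.union_inter_distrib_right, Set.not_nonempty_iff_eq_empty.1 hy, Set.union_empty,
          ← hVx x]
        exact measure_mono Set.inter_subset_left
    · refine ennreal_rpow_sub_mul_rpow_le hp hpq hD0 hDt hV0 hVt
        (measure_mono Set.inter_subset_right) ?_
      rw [hE, Set.union_inter_distrib_right, Set.not_nonempty_iff_eq_empty.1 hx, Set.empty_union,
        ← hVx y]
      exact measure_mono Set.inter_subset_left
  calc volume D ^ ((1:ℝ)/q - 1/p) *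
        (∫⁻ z in D, ENNReal.ofReal (|twoBumps x y s t z| ^ p)) ^ ((1:ℝ)/p)
      ≤ volume D ^ ((1:ℝ)/q - 1/p) * (ENNReal.ofReal m ^ p * volume (E ∩ D)) ^ ((1:ℝ)/p) := by
        gcongr
    _ = ENNReal.ofReal m * (volume D ^ ((1:ℝ)/q - 1/p) * volume (E ∩ D) ^ ((1:ℝ)/p)) := by
        rw [ENNReal.mul_rpow_of_nonneg _ _ hp'.le, ← ENNReal.rpow_mul,
          mul_one_div_cancel hp.ne', ENNReal.rpow_one]
        ring
    _ ≤ ENNReal.ofReal m * V ^ (1 / q) := by gcongr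

/-- The span of the indicators of two distant unit balls is isometric, up to a factor, to `ℝ²` with
the sup norm. -/
theorem morreyNorm_twoBumps (hp : 0 < p) (hpq : p < q) (hd : 1 ≤ d)
    {x y : EuclideanSpace ℝ (Fin d)}
    (hxy : 2 + 2 * (2:ℝ) ^ ((1 / p) / (1 / p - 1 / q)) ≤ dist x y) (s t : ℝ) :
    morreyNorm p q d (twoBumps x y s t) = ENNReal.ofReal (max |s| |t|) *
      volume (Metric.ball (0 : EuclideanSpace ℝ (Fin d)) 1) ^ (1 / q) := by
  have h2 : 2 ≤ dist x y := by
    have : 0 < (2:ℝ) ^ ((1 / p) / (1 / p - 1 / q)) := by positivity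
    linarith
  refine le_antisymm
    (morreyNorm_twoBumps_le hp hpq hd hxy (le_max_left _ _) (le_max_right _ _)) ?_
  rcases max_choice |s| |t| with h | h
  · rw [h]
    exact le_morreyNorm_twoBumps q hp h2 s t
  · rw [h, twoBumps_comm]
    exact le_morreyNorm_twoBumps q hp (dist_comm x y ▸ h2) t s

end

/-- The Dunkl–Williams constant of the Morrey space `M^p_q(ℝ^d)` equals `4`
when `1 ≤ p < q < ∞` and `d ≥ 1`. -/
theorem dunklWilliams_morrey (p q : ℝ) (d : ℕ) (hp : 1 ≤ p) (hpq : p < q) (hd : 1 ≤ d) :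
    (⨆ (f : EuclideanSpace ℝ (Fin d) → ℝ) (g : EuclideanSpace ℝ (Fin d) → ℝ)
      (_ : Measurable f) (_ : Measurable g)
      (_ : morreyNorm p q d f ≠ ∞) (_ : morreyNorm p q d g ≠ ∞)
      (_ : morreyNorm p q d f ≠ 0) (_ : morreyNorm p q d g ≠ 0)
      (_ : morreyNorm p q d (f - g) ≠ 0),
      ((morreyNorm p q d f + morreyNorm p q d g) / morreyNorm p q d (f - g)) *
        morreyNorm p q d
          ((morreyNorm p q d f).toReal⁻¹ • f - (morreyNorm p q d g).toReal⁻¹ • g)) = 4 := by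
  have hp0 : 0 < p := zero_lt_one.trans_le hp
  have hq0 : 0 < q := hp0.trans hpq
  refine le_antisymm ?_ ?_
  · exact iSup_le fun f => iSup_le fun g => iSup_le fun hf => iSup_le fun hg => iSup_le fun hft =>
      iSup_le fun hgt => iSup_le fun hf0 => iSup_le fun hg0 => iSup_le fun _ =>
        dunklWilliams_morrey_le q hp hf hg hft hgt hf0 hg0
  have : Nonempty (Fin d) := ⟨⟨0, hd⟩⟩
  obtain ⟨y, hy⟩ := NormedSpace.exists_lt_norm ℝ (EuclideanSpace ℝ (Fin d))
    (2 + 2 * (2:ℝ) ^ ((1 / p) / (1 / p - 1 / q)))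
  have hxy : 2 + 2 * (2:ℝ) ^ ((1 / p) / (1 / p - 1 / q)) ≤ dist 0 y := by
    rw [dist_zero_left]
    exact hy.le
  obtain ⟨N, hN0, hN⟩ : ∃ N : ℝ, 0 < N ∧
      volume (Metric.ball (0 : EuclideanSpace ℝ (Fin d)) 1) ^ (1 / q) = ENNReal.ofReal N := by
    have hV0 := (Metric.measure_ball_pos volume (0 : EuclideanSpace ℝ (Fin d)) one_pos)
    have hVt := (measure_ball_lt_top (μ := volume) (x := (0 : EuclideanSpace ℝ (Fin d)))
      (r := 1)).ne
    have ht := ENNReal.rpow_ne_top_of_nonneg (y := 1 / q) (by positivity) hVt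
    exact ⟨_, ENNReal.toReal_pos (ENNReal.rpow_pos hV0 hVt).ne' ht, (ENNReal.ofReal_toReal ht).symm⟩
  have hnorm (s t : ℝ) : morreyNorm p q d (twoBumps 0 y s t) =
      ENNReal.ofReal (max |s| |t| * N) := by
    rw [morreyNorm_twoBumps hp0 hpq hd hxy, hN, ENNReal.ofReal_mul (by positivity)]
  have hlim : Filter.Tendsto (fun ε : ℝ => ENNReal.ofReal (2 * (2 + ε) / (1 + ε)))
      (nhdsWithin 0 (Set.Ioo 0 1)) (nhds 4) := by
    have h4 : (4 : ℝ≥0∞) = ENNReal.ofReal (2 * (2 + 0) / (1 + 0)) := by norm_num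
    rw [h4]
    refine ENNReal.tendsto_ofReal (Filter.Tendsto.mono_left ?_ nhdsWithin_le_nhds)
    exact ContinuousAt.tendsto (f := fun ε : ℝ => 2 * (2 + ε) / (1 + ε))
      (ContinuousAt.div (by fun_prop) (by fun_prop) (by norm_num))
  have hne : (nhdsWithin (0:ℝ) (Set.Ioo 0 1)).NeBot := left_nhdsWithin_Ioo_neBot one_pos
  refine le_of_tendsto hlim ?_
  filter_upwards [self_mem_nhdsWithin] with ε hε
  obtain ⟨hε0, hε1⟩ := hε
  have hf : morreyNorm p q d (twoBumps 0 y 1 1) = ENNReal.ofReal N := by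
    simp [hnorm]
  have hg : morreyNorm p q d (twoBumps 0 y (1 + ε) (1 - ε)) = ENNReal.ofReal ((1 + ε) * N) := by
    rw [hnorm, abs_of_pos (by linarith), abs_of_pos (by linarith), max_eq_left (by linarith)]
  have hfg : morreyNorm p q d (twoBumps 0 y 1 1 - twoBumps 0 y (1 + ε) (1 - ε)) =
      ENNReal.ofReal (ε * N) := by
    rw [twoBumps_sub_twoBumps, hnorm]
    simp [abs_of_pos hε0]
  have hgN : 0 < (1 + ε) * N := by positivity
  refine le_iSup_of_le (twoBumps 0 y 1 1) <| le_iSup_of_le (twoBumps 0 y (1 + ε) (1 - ε)) <|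
    le_iSup_of_le (measurable_twoBumps _ _ _ _) <| le_iSup_of_le (measurable_twoBumps _ _ _ _) <|
    le_iSup_of_le (by simp [hf]) <| le_iSup_of_le (by rw [hg]; exact ENNReal.ofReal_ne_top) <|
    le_iSup_of_le (by simpa [hf] using hN0) <|
    le_iSup_of_le (by rw [hg]; exact (ENNReal.ofReal_pos.2 hgN).ne') <|
    le_iSup_of_le (by rw [hfg]; exact (ENNReal.ofReal_pos.2 (mul_pos hε0 hN0)).ne') <|
    le_of_eq ?_
  rw [hfg, hf, hg, ENNReal.toReal_ofReal hN0.le, ENNReal.toReal_ofReal hgN.le, smul_twoBumps,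
    smul_twoBumps, twoBumps_sub_twoBumps, hnorm]
  have h1 : N⁻¹ * 1 - ((1 + ε) * N)⁻¹ * (1 + ε) = 0 := by
    field_simp
    ring
  have h2 : N⁻¹ * 1 - ((1 + ε) * N)⁻¹ * (1 - ε) = 2 * ε / ((1 + ε) * N) := by
    field_simp
    ring
  rw [h1, h2, abs_zero, abs_of_pos (by positivity), max_eq_right (by positivity),
    ← ENNReal.ofReal_add hN0.le hgN.le, ← ENNReal.ofReal_div_of_pos (by positivity),
    ← ENNReal.ofReal_mul (by positivity)]
  congr 1
  field_simp
  ring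
end

section
/- Let 1 ≤ p < q < ∞ and d ≥ 1. Then the Dunkl–Williams constant of the local Morrey space LM^p_q(ℝ^d) equals 4; that is, sup{ ((‖f‖_{LM^p_q} + ‖g‖_{LM^p_q}) / ‖f−g‖_{LM^p_q}) · ‖ f/‖f‖_{LM^p_q} − g/‖g‖_{LM^p_q} ‖_{LM^p_q} : f, g ∈ LM^p_q(ℝ^d), f ≠ 0, g ≠ 0, f ≠ g } = 4. -/
open MeasureTheory
open scoped ENNReal

/-- The local Morrey norm `‖f‖_{LM^p_q}` of a (measurable) function on `ℝ^d`:
the supremum over all balls `B = B(0,r)` centered at the origin of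
`|B|^(1/q - 1/p) (∫_B |f|^p)^(1/p)`. -/
noncomputable def localMorreyNorm (p q : ℝ) (d : ℕ) (f : EuclideanSpace ℝ (Fin d) → ℝ) : ℝ≥0∞ :=
  ⨆ (r : ℝ) (_ : 0 < r),
    volume (Metric.ball (0 : EuclideanSpace ℝ (Fin d)) r) ^ ((1:ℝ)/q - 1/p) *
      (∫⁻ y in Metric.ball (0 : EuclideanSpace ℝ (Fin d)) r, ENNReal.ofReal (|f y| ^ p)) ^ ((1:ℝ)/p)

open Filter Topology

local notation "𝔼" d => EuclideanSpace ℝ (Fin d)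

/-- The quantity whose supremum over all radii `r > 0` is the local Morrey norm. -/
noncomputable def localMorreyTerm (p q : ℝ) (d : ℕ) (f : (𝔼 d) → ℝ) (r : ℝ) : ℝ≥0∞ :=
  volume (Metric.ball (0 : 𝔼 d) r) ^ ((1:ℝ)/q - 1/p) *
    (∫⁻ y in Metric.ball (0 : 𝔼 d) r, ENNReal.ofReal (|f y| ^ p)) ^ ((1:ℝ)/p)

section General

variable {p q : ℝ} {d : ℕ} {f g : (𝔼 d) → ℝ}

lemma localMorreyTerm_le_norm {r : ℝ} (hr : 0 < r) :
    localMorreyTerm p q d f r ≤ localMorreyNorm p q d f :=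
  le_iSup₂_of_le (f := fun r (_ : 0 < r) => localMorreyTerm p q d f r) r hr le_rfl

lemma localMorreyNorm_le {c : ℝ≥0∞} (h : ∀ r, 0 < r → localMorreyTerm p q d f r ≤ c) :
    localMorreyNorm p q d f ≤ c :=
  iSup₂_le h

lemma localMorreyTerm_mono (hp : 0 < p) (h : ∀ x, |f x| ≤ |g x|) (r : ℝ) :
    localMorreyTerm p q d f r ≤ localMorreyTerm p q d g r := by
  unfold localMorreyTerm
  have (x : 𝔼 d) : ENNReal.ofReal (|f x| ^ p) ≤ ENNReal.ofReal (|g x| ^ p) :=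
    ENNReal.ofReal_le_ofReal (Real.rpow_le_rpow (abs_nonneg _) (h x) hp.le)
  exact mul_le_mul' le_rfl (ENNReal.rpow_le_rpow (lintegral_mono this) (by positivity))

lemma localMorreyTerm_const_mul (hp : 0 < p) (c : ℝ) (f : (𝔼 d) → ℝ) (r : ℝ) :
    localMorreyTerm p q d (fun x => c * f x) r =
      ENNReal.ofReal |c| * localMorreyTerm p q d f r := by
  have h (x : 𝔼 d) : ENNReal.ofReal (|c * f x| ^ p) =
      ENNReal.ofReal |c| ^ p * ENNReal.ofReal (|f x| ^ p) := by
    rw [abs_mul, Real.mul_rpow (abs_nonneg _) (abs_nonneg _), ENNReal.ofReal_mul (by positivity),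
      ENNReal.ofReal_rpow_of_nonneg (abs_nonneg _) hp.le]
  simp only [localMorreyTerm, h]
  rw [lintegral_const_mul' _ _ (ENNReal.rpow_ne_top_of_nonneg hp.le ENNReal.ofReal_ne_top),
    ENNReal.mul_rpow_of_nonneg _ _ (by positivity), ← ENNReal.rpow_mul,
    mul_one_div_cancel hp.ne', ENNReal.rpow_one]
  ring

lemma localMorreyTerm_add_le (hp : 1 ≤ p) (hf : Measurable f) (hg : Measurable g) (r : ℝ) :
    localMorreyTerm p q d (f + g) r ≤ localMorreyTerm p q d f r + localMorreyTerm p q d g r := by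
  have hp0 : 0 ≤ p := by linarith
  simp only [localMorreyTerm, ← mul_add]
  gcongr
  simp only [← ENNReal.ofReal_rpow_of_nonneg (abs_nonneg _) hp0]
  refine le_trans ?_ (ENNReal.lintegral_Lp_add_le (f := fun x => ENNReal.ofReal |f x|)
    (g := fun x => ENNReal.ofReal |g x|) hf.abs.ennreal_ofReal.aemeasurable
    hg.abs.ennreal_ofReal.aemeasurable hp)
  gcongr with y
  simp only [Pi.add_apply]
  rw [← ENNReal.ofReal_add (abs_nonneg _) (abs_nonneg _)]
  exact ENNReal.ofReal_le_ofReal (abs_add_le _ _)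

lemma localMorreyNorm_smul (hp : 0 < p) (c : ℝ) (f : (𝔼 d) → ℝ) :
    localMorreyNorm p q d (c • f) = ENNReal.ofReal |c| * localMorreyNorm p q d f := by
  change ⨆ r, ⨆ _ : 0 < r, localMorreyTerm p q d (fun x => c * f x) r =
    _ * ⨆ r, ⨆ _ : 0 < r, localMorreyTerm p q d f r
  simp only [localMorreyTerm_const_mul hp, ENNReal.mul_iSup]

lemma localMorreyNorm_add_le (hp : 1 ≤ p) (hf : Measurable f) (hg : Measurable g) :
    localMorreyNorm p q d (f + g) ≤ localMorreyNorm p q d f + localMorreyNorm p q d g :=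
  localMorreyNorm_le fun r hr => (localMorreyTerm_add_le hp hf hg r).trans
    (add_le_add (localMorreyTerm_le_norm hr) (localMorreyTerm_le_norm hr))

lemma localMorreyNorm_sub_comm (hp : 0 < p) (f g : (𝔼 d) → ℝ) :
    localMorreyNorm p q d (f - g) = localMorreyNorm p q d (g - f) := by
  have := localMorreyNorm_smul (q := q) hp (-1) (f - g)
  simpa using this.symm

lemma toReal_localMorreyNorm_le_add_sub (hp : 1 ≤ p) (hf : Measurable f) (hg : Measurable g)
    (hg' : localMorreyNorm p q d g ≠ ∞) (h' : localMorreyNorm p q d (f - g) ≠ ∞) :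
    (localMorreyNorm p q d f).toReal ≤
      (localMorreyNorm p q d g).toReal + (localMorreyNorm p q d (f - g)).toReal := by
  rw [← ENNReal.toReal_add hg' h']
  refine ENNReal.toReal_mono (ENNReal.add_ne_top.2 ⟨hg', h'⟩) ?_
  simpa using localMorreyNorm_add_le (q := q) hp hg (hf.sub hg)

/-- Half of the Dunkl–Williams inequality: `‖f‖ ‖f / ‖f‖ - g / ‖g‖‖ ≤ 2 ‖f - g‖`. -/
lemma localMorreyNorm_mul_normalized_sub_le (hp : 1 ≤ p) (hf : Measurable f) (hg : Measurable g)
    (hf' : localMorreyNorm p q d f ≠ ∞) (hg' : localMorreyNorm p q d g ≠ ∞)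
    (hf0 : localMorreyNorm p q d f ≠ 0) (hg0 : localMorreyNorm p q d g ≠ 0) :
    localMorreyNorm p q d f * localMorreyNorm p q d
      ((localMorreyNorm p q d f).toReal⁻¹ • f - (localMorreyNorm p q d g).toReal⁻¹ • g) ≤
      2 * localMorreyNorm p q d (f - g) := by
  have hp0 : 0 < p := by linarith
  by_cases h' : localMorreyNorm p q d (f - g) = ∞
  · simp [h']
  have h'' : localMorreyNorm p q d (g - f) ≠ ∞ := by rwa [localMorreyNorm_sub_comm hp0]
  have h1 := toReal_localMorreyNorm_le_add_sub hp hf hg hg' h'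
  have h2 := toReal_localMorreyNorm_le_add_sub hp hg hf hf' h''
  rw [localMorreyNorm_sub_comm hp0 g f] at h2
  have ha := ENNReal.toReal_pos hf0 hf'
  have hb := ENNReal.toReal_pos hg0 hg'
  have hfa := ENNReal.ofReal_toReal hf'
  have hgb := ENNReal.ofReal_toReal hg'
  have hD := ENNReal.ofReal_toReal h'
  set a := (localMorreyNorm p q d f).toReal
  set b := (localMorreyNorm p q d g).toReal
  have key : localMorreyNorm p q d f * localMorreyNorm p q d (a⁻¹ • f - b⁻¹ • g) =
      localMorreyNorm p q d ((f - g) + (1 - a / b) • g) := by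
    rw [← hfa, ← abs_of_pos ha, ← localMorreyNorm_smul hp0, abs_of_pos ha]
    congr 1
    ext x
    simp only [Pi.smul_apply, Pi.sub_apply, Pi.add_apply, smul_eq_mul]
    field_simp
    ring
  rw [key, two_mul]
  refine (localMorreyNorm_add_le hp (hf.sub hg) (hg.const_smul _)).trans ?_
  gcongr
  rw [localMorreyNorm_smul hp0, ← hgb, ← hD, ← ENNReal.ofReal_mul (abs_nonneg _)]
  apply ENNReal.ofReal_le_ofReal
  have : |1 - a / b| * b = |b - a| := by
    nth_rw 2 [← abs_of_pos hb]
    rw [← abs_mul]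
    congr 1
    field_simp
  rw [this, abs_le]
  constructor <;> linarith

end General

section Extremal

variable {p q : ℝ} {d : ℕ}

/-- The function `|x|^(-d/q)`, multiplied by `a` inside and by `b` outside the unit ball. -/
noncomputable def twoPiecePower (q : ℝ) (d : ℕ) (a b : ℝ) (x : 𝔼 d) : ℝ :=
  (if ‖x‖ < 1 then a else b) * ‖x‖ ^ (-(d : ℝ) / q)

lemma measurable_twoPiecePower (a b : ℝ) : Measurable (twoPiecePower q d a b) :=
  (Measurable.ite (measurableSet_lt measurable_norm measurable_const) measurable_const
    measurable_const).mul (measurable_norm.pow_const _)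

lemma twoPiecePower_self (a : ℝ) :
    twoPiecePower q d a a = fun x => a * ‖x‖ ^ (-(d : ℝ) / q) := by
  ext x
  simp [twoPiecePower]

/-- Scaling of the integral of a power of the norm over centred balls. -/
lemma setLIntegral_ball_norm_rpow (s : ℝ) {r : ℝ} (hr : 0 < r) :
    ∫⁻ y in Metric.ball (0 : 𝔼 d) r, ENNReal.ofReal (‖y‖ ^ s) =
      ENNReal.ofReal (r ^ (d + s)) *
        ∫⁻ y in Metric.ball (0 : 𝔼 d) 1, ENNReal.ofReal (‖y‖ ^ s) := by
  have hm : Measurable fun y : 𝔼 d =>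
      (Metric.ball (0 : 𝔼 d) r).indicator (fun y => ENNReal.ofReal (‖y‖ ^ s)) y :=
    ((measurable_norm.pow_const _).ennreal_ofReal).indicator measurableSet_ball
  have h := lintegral_map (μ := volume) hm (measurable_const_smul r)
  rw [Measure.map_addHaar_smul volume hr.ne', lintegral_smul_measure,
    lintegral_indicator measurableSet_ball, finrank_euclideanSpace_fin] at h
  have h2 (x : 𝔼 d) : (Metric.ball (0 : 𝔼 d) r).indicator
      (fun y => ENNReal.ofReal (‖y‖ ^ s)) (r • x) = ENNReal.ofReal (r ^ s) *
      (Metric.ball (0 : 𝔼 d) 1).indicator (fun y => ENNReal.ofReal (‖y‖ ^ s)) x := by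
    have hn : ‖r • x‖ = r * ‖x‖ := by rw [norm_smul, Real.norm_of_nonneg hr.le]
    have : r * ‖x‖ < r ↔ ‖x‖ < 1 := by
      constructor <;> intro h <;> nlinarith
    simp only [Set.indicator, mem_ball_zero_iff, hn, this]
    split_ifs
    · rw [Real.mul_rpow hr.le (norm_nonneg _), ENNReal.ofReal_mul (by positivity)]
    · simp
  simp only [h2] at h
  rw [lintegral_const_mul' _ _ ENNReal.ofReal_ne_top, lintegral_indicator measurableSet_ball,
    abs_of_pos (by positivity), smul_eq_mul] at h
  have h3 : ENNReal.ofReal (r ^ d) * ENNReal.ofReal (r ^ d)⁻¹ = 1 := by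
    rw [← ENNReal.ofReal_mul (by positivity), mul_inv_cancel₀ (by positivity), ENNReal.ofReal_one]
  rw [Real.rpow_add hr, Real.rpow_natCast, ENNReal.ofReal_mul (by positivity), mul_assoc, ← h,
    ← mul_assoc, h3, one_mul]

lemma setLIntegral_ball_norm_rpow_ne_top (hd : 1 ≤ d) {s : ℝ} (hs : s < d) :
    ∫⁻ y in Metric.ball (0 : 𝔼 d) 1, ENNReal.ofReal (‖y‖ ^ (-s)) ≠ ∞ := by
  have : IntegrableOn (fun y : 𝔼 d => ‖y‖ ^ (-s)) (Metric.ball 0 1) volume := by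
    refine integrableOn_ball_of_norm_le_rpow (C := 1) (α := s) (by simpa using hd) (by simpa using hs)
      (.of_forall fun x => ?_) (measurable_norm.pow_const _).aestronglyMeasurable
    rw [Real.norm_of_nonneg (by positivity), one_mul]
  exact this.lintegral_lt_top.ne

lemma setLIntegral_ball_norm_rpow_ne_zero (hd : 1 ≤ d) (s : ℝ) :
    ∫⁻ y in Metric.ball (0 : 𝔼 d) 1, ENNReal.ofReal (‖y‖ ^ s) ≠ 0 := by
  have : Nontrivial (𝔼 d) := by
    apply Module.nontrivial_of_finrank_pos (R := ℝ)
    simpa using Nat.lt_of_lt_of_le Nat.zero_lt_one hd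
  refine ((setLIntegral_pos_iff (measurable_norm.pow_const _).ennreal_ofReal).2 ?_).ne'
  refine lt_of_lt_of_le (Metric.measure_ball_pos volume (0 : 𝔼 d) one_pos) ?_
  rw [← measure_sdiff_null (t := {(0 : 𝔼 d)}) (measure_singleton _)]
  refine measure_mono fun x hx => ⟨?_, hx.1⟩
  have : 0 < ‖x‖ := norm_pos_iff.2 hx.2
  simp only [Function.mem_support]
  exact (ENNReal.ofReal_pos.2 (by positivity)).ne'

/-- The local Morrey norm of `|x|^(-d/q)`. -/
noncomputable def powerMorreyConst (p q : ℝ) (d : ℕ) : ℝ≥0∞ :=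
  localMorreyTerm p q d (fun x => ‖x‖ ^ (-(d : ℝ) / q)) 1

lemma abs_norm_rpow_rpow (x : 𝔼 d) :
    |‖x‖ ^ (-(d : ℝ) / q)| ^ p = ‖x‖ ^ (-(d * p / q)) := by
  rw [abs_of_nonneg (by positivity), ← Real.rpow_mul (norm_nonneg _)]
  congr 1
  ring

lemma volume_ball_rpow {r : ℝ} (hr : 0 < r) (e : ℝ) :
    volume (Metric.ball (0 : 𝔼 d) r) ^ e =
      ENNReal.ofReal (r ^ (d * e)) * volume (Metric.ball (0 : 𝔼 d) 1) ^ e := by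
  rw [Measure.addHaar_ball_of_pos _ _ hr, finrank_euclideanSpace_fin,
    ENNReal.mul_rpow_of_ne_top ENNReal.ofReal_ne_top measure_ball_lt_top.ne,
    ENNReal.ofReal_rpow_of_pos (by positivity), ← Real.rpow_natCast, ← Real.rpow_mul hr.le]

lemma localMorreyTerm_power (hp : 0 < p) (hq : 0 < q) {r : ℝ} (hr : 0 < r) :
    localMorreyTerm p q d (fun x => ‖x‖ ^ (-(d : ℝ) / q)) r = powerMorreyConst p q d := by
  simp only [powerMorreyConst, localMorreyTerm, abs_norm_rpow_rpow]
  rw [setLIntegral_ball_norm_rpow _ hr, volume_ball_rpow hr,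
    ENNReal.mul_rpow_of_nonneg _ _ (by positivity), ENNReal.ofReal_rpow_of_pos (by positivity),
    mul_mul_mul_comm, ← ENNReal.ofReal_mul (by positivity), ← Real.rpow_mul hr.le,
    ← Real.rpow_add hr]
  have : (d * (1 / q - 1 / p) + (d + -(d * p / q)) * (1 / p) : ℝ) = 0 := by
    field_simp
    ring
  rw [this]
  simp

lemma powerMorreyConst_ne_top (hp : 0 < p) (hpq : p < q) (hd : 1 ≤ d) :
    powerMorreyConst p q d ≠ ∞ := by
  have hq := hp.trans hpq
  have hd' : (0 : ℝ) < d := by exact_mod_cast hd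
  simp only [powerMorreyConst, localMorreyTerm, abs_norm_rpow_rpow]
  refine ENNReal.mul_ne_top (ENNReal.rpow_ne_top_of_ne_zero
    (Metric.measure_ball_pos _ _ one_pos).ne' measure_ball_lt_top.ne)
    (ENNReal.rpow_ne_top_of_nonneg (by positivity) (setLIntegral_ball_norm_rpow_ne_top hd ?_))
  rw [div_lt_iff₀ hq]
  gcongr

lemma powerMorreyConst_ne_zero (hp : 0 < p) (hd : 1 ≤ d) :
    powerMorreyConst p q d ≠ 0 := by
  simp only [powerMorreyConst, localMorreyTerm, abs_norm_rpow_rpow]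
  refine mul_ne_zero ?_ ?_
  · simp [ENNReal.rpow_eq_zero_iff, (Metric.measure_ball_pos volume (0 : 𝔼 d) one_pos).ne',
      (measure_ball_lt_top (μ := volume) (x := (0 : 𝔼 d)) (r := 1)).ne]
  · have h := setLIntegral_ball_norm_rpow_ne_zero hd (-(d * p / q))
    rw [ne_eq, ENNReal.rpow_eq_zero_iff]
    rintro (⟨h0, -⟩ | ⟨-, h0⟩)
    · exact h h0
    · have : 0 < 1 / p := by positivity
      linarith

lemma localMorreyTerm_twoPiecePower_self (hp : 0 < p) (hq : 0 < q) (a : ℝ) {r : ℝ} (hr : 0 < r) :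
    localMorreyTerm p q d (twoPiecePower q d a a) r =
      ENNReal.ofReal |a| * powerMorreyConst p q d := by
  rw [twoPiecePower_self, localMorreyTerm_const_mul hp, localMorreyTerm_power hp hq hr]

lemma localMorreyTerm_twoPiecePower_one (hp : 0 < p) (hq : 0 < q) (a b : ℝ) :
    localMorreyTerm p q d (twoPiecePower q d a b) 1 =
      ENNReal.ofReal |a| * powerMorreyConst p q d := by
  rw [← localMorreyTerm_twoPiecePower_self hp hq a one_pos]
  unfold localMorreyTerm
  congr 2
  refine setLIntegral_congr_fun measurableSet_ball fun x hx => ?_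
  have : ‖x‖ < 1 := by simpa using hx
  simp [twoPiecePower, this]

/-- A function supported in the unit ball contributes nothing on large balls. -/
lemma tendsto_localMorreyTerm_twoPiecePower_zero (hp : 0 < p) (hpq : p < q) (hd : 1 ≤ d) (a : ℝ) :
    Tendsto (localMorreyTerm p q d (twoPiecePower q d a 0)) atTop (𝓝 0) := by
  have hq := hp.trans hpq
  have hd' : (0 : ℝ) < d := by exact_mod_cast hd
  set K := ENNReal.ofReal |a| * powerMorreyConst p q d with hK
  have hK' : K ≠ ∞ := ENNReal.mul_ne_top ENNReal.ofReal_ne_top (powerMorreyConst_ne_top hp hpq hd)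
  have he : d * (1 / q - 1 / p) < 0 := by
    have := one_div_lt_one_div_of_lt hp hpq
    exact mul_neg_of_pos_of_neg hd' (by linarith)
  have hlim : Tendsto (fun r : ℝ => ENNReal.ofReal (r ^ (d * (1 / q - 1 / p))) * K)
      atTop (𝓝 0) := by
    have h := tendsto_rpow_neg_atTop (neg_pos.2 he)
    rw [neg_neg] at h
    simpa using ENNReal.Tendsto.mul_const (ENNReal.tendsto_ofReal h) (.inr hK')
  refine tendsto_of_tendsto_of_tendsto_of_le_of_le' tendsto_const_nhds hlim
    (.of_forall fun _ => zero_le) ?_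
  filter_upwards [eventually_ge_atTop 1] with r hr
  rw [hK, ← localMorreyTerm_twoPiecePower_one hp hq a 0]
  unfold localMorreyTerm
  rw [volume_ball_rpow (by linarith), mul_assoc]
  refine mul_le_mul' le_rfl (mul_le_mul' le_rfl (ENNReal.rpow_le_rpow ?_ (by positivity)))
  rw [← lintegral_indicator measurableSet_ball, ← lintegral_indicator measurableSet_ball]
  refine lintegral_mono fun x => ?_
  by_cases hx : ‖x‖ < 1
  · simp [Set.indicator, hx, hx.trans_le hr]
  · simp [Set.indicator, hx, twoPiecePower, Real.zero_rpow hp.ne']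

/-- The functions `twoPiecePower q d a b` span an isometric copy of the plane with the
maximum norm. -/
lemma localMorreyNorm_twoPiecePower (hp : 1 ≤ p) (hpq : p < q) (hd : 1 ≤ d) (a b : ℝ) :
    localMorreyNorm p q d (twoPiecePower q d a b) =
      ENNReal.ofReal (max |a| |b|) * powerMorreyConst p q d := by
  have hp0 : 0 < p := by linarith
  have hq := hp0.trans hpq
  apply le_antisymm
  · refine localMorreyNorm_le fun r hr => ?_
    have hM : 0 ≤ max |a| |b| := (abs_nonneg a).trans (le_max_left _ _)
    have := localMorreyTerm_twoPiecePower_self (d := d) hp0 hq (max |a| |b|) hr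
    rw [abs_of_nonneg hM] at this
    rw [← this]
    refine localMorreyTerm_mono hp0 (fun x => ?_) r
    simp only [twoPiecePower, abs_mul]
    refine mul_le_mul_of_nonneg_right ?_ (abs_nonneg _)
    rw [ite_self, abs_of_nonneg hM]
    split_ifs
    exacts [le_max_left _ _, le_max_right _ _]
  · have h1 : ENNReal.ofReal |a| * powerMorreyConst p q d ≤
        localMorreyNorm p q d (twoPiecePower q d a b) := by
      rw [← localMorreyTerm_twoPiecePower_one hp0 hq a b]
      exact localMorreyTerm_le_norm one_pos
    have h2 : ENNReal.ofReal |b| * powerMorreyConst p q d ≤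
        localMorreyNorm p q d (twoPiecePower q d a b) := by
      have hlim := (tendsto_localMorreyTerm_twoPiecePower_zero hp0 hpq hd (b - a)).const_add
        (localMorreyNorm p q d (twoPiecePower q d a b))
      rw [add_zero] at hlim
      refine ge_of_tendsto hlim ?_
      filter_upwards [eventually_gt_atTop 0] with r hr
      rw [← localMorreyTerm_twoPiecePower_self hp0 hq b hr]
      have : twoPiecePower q d b b = twoPiecePower q d a b + twoPiecePower q d (b - a) 0 := by
        ext x
        simp only [twoPiecePower, Pi.add_apply]
        split_ifs <;> ring
      rw [this]
      exact (localMorreyTerm_add_le hp (measurable_twoPiecePower _ _)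
        (measurable_twoPiecePower _ _) r).trans (add_le_add_left (localMorreyTerm_le_norm hr) _)
    rcases max_cases |a| |b| with h | h <;> rw [h.1] <;> assumption

end Extremal

/-- The Dunkl–Williams constant of the local Morrey space `LM^p_q(ℝ^d)` equals `4`
when `1 ≤ p < q < ∞` and `d ≥ 1`. -/
theorem dunklWilliams_localMorrey (p q : ℝ) (d : ℕ) (hp : 1 ≤ p) (hpq : p < q) (hd : 1 ≤ d) :
    (⨆ (f : EuclideanSpace ℝ (Fin d) → ℝ) (g : EuclideanSpace ℝ (Fin d) → ℝ)
      (_ : Measurable f) (_ : Measurable g)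
      (_ : localMorreyNorm p q d f ≠ ∞) (_ : localMorreyNorm p q d g ≠ ∞)
      (_ : localMorreyNorm p q d f ≠ 0) (_ : localMorreyNorm p q d g ≠ 0)
      (_ : localMorreyNorm p q d (f - g) ≠ 0),
      ((localMorreyNorm p q d f + localMorreyNorm p q d g) / localMorreyNorm p q d (f - g)) *
        localMorreyNorm p q d
          ((localMorreyNorm p q d f).toReal⁻¹ • f -
            (localMorreyNorm p q d g).toReal⁻¹ • g)) = 4 := by
  have hp0 : 0 < p := by linarith
  apply le_antisymm
  · refine iSup_le fun f => iSup_le fun g => iSup_le fun hf => iSup_le fun hg => iSup_le fun hf' =>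
      iSup_le fun hg' => iSup_le fun hf0 => iSup_le fun hg0 => iSup_le fun h0 => ?_
    have h1 := localMorreyNorm_mul_normalized_sub_le hp hf hg hf' hg' hf0 hg0
    have h2 := localMorreyNorm_mul_normalized_sub_le hp hg hf hg' hf' hg0 hf0
    rw [localMorreyNorm_sub_comm hp0, localMorreyNorm_sub_comm hp0 g f] at h2
    rw [← ENNReal.mul_div_right_comm]
    refine ENNReal.div_le_of_le_mul ?_
    rw [add_mul]
    refine (add_le_add h1 h2).trans_eq ?_
    rw [← add_mul]
    norm_num
  · have hlim : Tendsto (fun δ : ℝ => ENNReal.ofReal (4 - 2 * δ)) (𝓝[>] 0) (𝓝 4) := by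
      have : Tendsto (fun δ : ℝ => ENNReal.ofReal (4 - 2 * δ)) (𝓝 0)
          (𝓝 (ENNReal.ofReal (4 - 2 * 0))) :=
        ENNReal.tendsto_ofReal (Continuous.tendsto (by fun_prop) 0)
      simp only [mul_zero, sub_zero, ENNReal.ofReal_ofNat] at this
      exact this.mono_left nhdsWithin_le_nhds
    refine le_of_tendsto hlim ?_
    filter_upwards [Ioo_mem_nhdsGT (show (0 : ℝ) < 1 / 2 by norm_num)] with δ hδ
    obtain ⟨hδ0, hδ1⟩ := hδ
    have hC := powerMorreyConst_ne_top hp0 hpq hd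
    have hC0 := powerMorreyConst_ne_zero (q := q) hp0 hd
    have hc := ENNReal.toReal_pos hC0 hC
    have hN (a b : ℝ) : localMorreyNorm p q d (twoPiecePower q d a b) =
        ENNReal.ofReal (max |a| |b| * (powerMorreyConst p q d).toReal) := by
      rw [localMorreyNorm_twoPiecePower hp hpq hd,
        ENNReal.ofReal_mul ((abs_nonneg a).trans (le_max_left _ _)), ENNReal.ofReal_toReal hC]
    set c := (powerMorreyConst p q d).toReal
    have hNf : localMorreyNorm p q d (twoPiecePower q d 1 (1 - 2 * δ)) = ENNReal.ofReal c := by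
      rw [hN, abs_one, abs_of_pos (by linarith), max_eq_left (by linarith), one_mul]
    have hNg : localMorreyNorm p q d (twoPiecePower q d (1 - δ) (1 - δ)) =
        ENNReal.ofReal ((1 - δ) * c) := by
      rw [hN, abs_of_pos (by linarith), max_self]
    have hNsub : localMorreyNorm p q d
        (twoPiecePower q d 1 (1 - 2 * δ) - twoPiecePower q d (1 - δ) (1 - δ)) =
        ENNReal.ofReal (δ * c) := by
      have : twoPiecePower q d 1 (1 - 2 * δ) - twoPiecePower q d (1 - δ) (1 - δ) =
          twoPiecePower q d δ (-δ) := by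
        ext x
        simp only [twoPiecePower, Pi.sub_apply]
        split_ifs <;> ring
      rw [this, hN, abs_neg, max_self, abs_of_pos hδ0]
    have hgc : 0 < (1 - δ) * c := mul_pos (by linarith) hc
    have hNnormalized : localMorreyNorm p q d (c⁻¹ • twoPiecePower q d 1 (1 - 2 * δ) -
        ((1 - δ) * c)⁻¹ • twoPiecePower q d (1 - δ) (1 - δ)) = ENNReal.ofReal (2 * δ) := by
      have : c⁻¹ • twoPiecePower q d 1 (1 - 2 * δ) -
          ((1 - δ) * c)⁻¹ • twoPiecePower q d (1 - δ) (1 - δ) =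
          twoPiecePower q d 0 (-(2 * δ / c)) := by
        have h1 : 1 - δ ≠ 0 := by linarith
        ext x
        simp only [twoPiecePower, Pi.sub_apply, Pi.smul_apply, smul_eq_mul]
        split_ifs <;> field_simp <;> ring
      rw [this, hN, abs_neg, abs_zero, abs_of_pos (by positivity), max_eq_right (by positivity),
        div_mul_cancel₀ _ hc.ne']
    refine le_iSup_of_le (twoPiecePower q d 1 (1 - 2 * δ)) <|
      le_iSup_of_le (twoPiecePower q d (1 - δ) (1 - δ)) <|
      le_iSup_of_le (measurable_twoPiecePower _ _) <|
      le_iSup_of_le (measurable_twoPiecePower _ _) ?_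
    rw [hNf, hNg, hNsub, ENNReal.toReal_ofReal hc.le, ENNReal.toReal_ofReal hgc.le, hNnormalized]
    refine le_iSup_of_le ENNReal.ofReal_ne_top <| le_iSup_of_le ENNReal.ofReal_ne_top <|
      le_iSup_of_le (ENNReal.ofReal_pos.2 hc).ne' <|
      le_iSup_of_le (ENNReal.ofReal_pos.2 hgc).ne' <|
      le_iSup_of_le (ENNReal.ofReal_pos.2 (by positivity)).ne' ?_
    rw [← ENNReal.ofReal_add hc.le hgc.le, ← ENNReal.ofReal_div_of_pos (by positivity),
      ← ENNReal.ofReal_mul (by positivity)]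
    apply le_of_eq
    congr 1
    field_simp
    ring
end
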